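/- Let 𝒜 be an abelian category and let A be an object of 𝒜 whose endomorphism ring End(A) is a division ring. Suppose 0 → A →ι E →p A → 0 is a short exact sequence in 𝒜 that does not split. Then E is not isomorphic to the direct sum A ⊕ A. -/

import Mathlib

open CategoryTheory Limits

/-- A nonzero composite `i ≫ p : A ⟶ A` yields a section of `p` when every nonzero endomorphism
of `A` is invertible. -/
lemma exists_section_of_comp_ne_zero {C : Type*} [Category C] [Preadditive C] {A E : C}
    (hdiv : ∀ f : CategoryTheory.End A, f ≠ 0 → IsUnit f)
    {i : A ⟶ E} {p : E ⟶ A} (h : i ≫ p ≠ 0) : ∃ s : A ⟶ E, s ≫ p = 𝟙 A := by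
  have : IsIso (i ≫ p) := (isUnit_iff_isIso (i ≫ p)).mp (hdiv (i ≫ p) h)
  exact ⟨inv (i ≫ p) ≫ i, by rw [Category.assoc, IsIso.inv_hom_id]⟩

/-- If `End(A)` is a division ring (every nonzero endomorphism is invertible) and
`0 → A → E → A → 0` is a short exact sequence that does not split, then `E` is not
isomorphic to `A ⊕ A`. -/
theorem nonsplit_extension_not_iso_biprod
    {𝒜 : Type*} [Category 𝒜] [Abelian 𝒜] (A E : 𝒜)
    (hdiv : ∀ f : CategoryTheory.End A, f ≠ 0 → IsUnit f)
    (ι : A ⟶ E) (p : E ⟶ A) (w : ι ≫ p = 0)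
    (hse : (ShortComplex.mk ι p w).ShortExact)
    (hnosplit : ¬ ∃ s : A ⟶ E, s ≫ p = 𝟙 A) :
    IsEmpty (E ≅ A ⊞ A) := by
  refine ⟨fun e => hnosplit ?_⟩
  by_cases hl : (biprod.inl ≫ e.inv) ≫ p = 0
  · by_cases hr : (biprod.inr ≫ e.inv) ≫ p = 0
    · have hp : p = 0 := by
        rw [← cancel_epi e.inv, comp_zero]
        apply biprod.hom_ext'
        · simpa using hl
        · simpa using hr
      have : Epi p := hse.epi_g
      refine ⟨0, ?_⟩
      rw [← cancel_epi p]
      simp [hp]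
    · exact exists_section_of_comp_ne_zero hdiv hr
  · exact exists_section_of_comp_ne_zero hdiv hl
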